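/- Let z ∈ ℂ with Im z > 0 and write z̄ for its complex conjugate. Then the matrix (A^{z̄}_N)^* + i (C^{z̄}_N)^* is invertible and ∫_{U(L)} G^z_N(0, Z(U)) dU = [(B^{z̄}_N)^* + i (D^{z̄}_N)^*] · [(A^{z̄}_N)^* + i (C^{z̄}_N)^*]^{-1}, where the integral is over the normalized Haar measure on U(L), with left Dirichlet boundary condition Ẑ = 0 and right boundary condition Z(U) = −i(1+U)(1−U)^{-1} (defined for Haar-almost every U). -/

import Mathlib

open MeasureTheory Matrix
open scoped ComplexOrder

noncomputable section

/-- The space of complex `L × L` matrices. -/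
abbrev Mat (L : ℕ) := Matrix (Fin L) (Fin L) ℂ

/-- The `2L × 2L` transfer matrix `[[(z − V)T⁻¹, −T^*], [T⁻¹, 0]]`. -/
def transferM (L : ℕ) (z : ℂ) (T V : Mat L) : Matrix (Fin L ⊕ Fin L) (Fin L ⊕ Fin L) ℂ :=
  Matrix.fromBlocks ((z • (1 : Mat L) - V) * T⁻¹) (-(Tᴴ)) T⁻¹ 0

/-- The transfer matrix across the sample, `𝒯^z(N,0) = 𝒯_N^z ⋯ 𝒯_1^z`. -/
def transferProd (L N : ℕ) (T V : ℕ → Mat L) (z : ℂ) :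
    Matrix (Fin L ⊕ Fin L) (Fin L ⊕ Fin L) ℂ :=
  (((List.range N).map (fun n => transferM L z (T (n + 1)) (V (n + 1)))).reverse).prod

def blockA (L N : ℕ) (T V : ℕ → Mat L) (z : ℂ) : Mat L := (transferProd L N T V z).toBlocks₁₁
def blockB (L N : ℕ) (T V : ℕ → Mat L) (z : ℂ) : Mat L := (transferProd L N T V z).toBlocks₁₂
def blockC (L N : ℕ) (T V : ℕ → Mat L) (z : ℂ) : Mat L := (transferProd L N T V z).toBlocks₂₁
def blockD (L N : ℕ) (T V : ℕ → Mat L) (z : ℂ) : Mat L := (transferProd L N T V z).toBlocks₂₂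

/-- The block tridiagonal Jacobi matrix `H^N_{Ẑ,Z}` (sites `1,…,N` are indexed by `Fin N`). -/
def jacobi (L N : ℕ) (T V : ℕ → Mat L) (Zh Z : Mat L) :
    Matrix (Fin N × Fin L) (Fin N × Fin L) ℂ :=
  Matrix.of fun p q =>
    if p.1 = q.1 then
      (V (p.1.val + 1) - (if p.1.val = 0 then Zh else 0)
        - (if p.1.val = N - 1 then Z else 0)) p.2 q.2
    else if q.1.val = p.1.val + 1 then T (p.1.val + 2) p.2 q.2
    else if p.1.val = q.1.val + 1 then (T (q.1.val + 2))ᴴ p.2 q.2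
    else 0

/-- The Green matrix `G^z_N(Ẑ,Z) = π₁^* (H^N_{Ẑ,Z} − z)⁻¹ π₁`. -/
def green (L N : ℕ) (hN : 0 < N) (T V : ℕ → Mat L) (Zh Z : Mat L) (z : ℂ) : Mat L :=
  Matrix.of fun i j => (jacobi L N T V Zh Z - z • 1)⁻¹ (⟨0, hN⟩, i) (⟨0, hN⟩, j)

instance (L : ℕ) : MeasurableSpace (Matrix.unitaryGroup (Fin L) ℂ) := borel _

/-- The right boundary condition `Z(U) = −i(1+U)(1−U)⁻¹` associated with a unitary `U`. -/
def ZofU (L : ℕ) (U : Matrix.unitaryGroup (Fin L) ℂ) : Mat L :=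
  -(Complex.I • ((1 + (U : Mat L)) * (1 - (U : Mat L))⁻¹))


section

variable {L : ℕ}

/-- Transfer matrices applied to the initial condition `(a, b)`. -/
def transferState (T V : ℕ → Mat L) (z : ℂ) (a b : Fin L → ℂ) (n : ℕ) : Fin L ⊕ Fin L → ℂ :=
  transferProd L n T V z *ᵥ Sum.elim a b

def transferUpper (T V : ℕ → Mat L) (z : ℂ) (a b : Fin L → ℂ) (n : ℕ) : Fin L → ℂ :=
  transferState T V z a b n ∘ Sum.inl

def transferLower (T V : ℕ → Mat L) (z : ℂ) (a b : Fin L → ℂ) (n : ℕ) : Fin L → ℂ :=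
  transferState T V z a b n ∘ Sum.inr

lemma transferUpper_eq (T V : ℕ → Mat L) (z : ℂ) (a b : Fin L → ℂ) (n : ℕ) :
    transferUpper T V z a b n = blockA L n T V z *ᵥ a + blockB L n T V z *ᵥ b := by
  rw [transferUpper, transferState, ← fromBlocks_toBlocks (transferProd L n T V z),
    fromBlocks_mulVec]
  simp [blockA, blockB]

lemma transferLower_eq (T V : ℕ → Mat L) (z : ℂ) (a b : Fin L → ℂ) (n : ℕ) :
    transferLower T V z a b n = blockC L n T V z *ᵥ a + blockD L n T V z *ᵥ b := by
  rw [transferLower, transferState, ← fromBlocks_toBlocks (transferProd L n T V z),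
    fromBlocks_mulVec]
  simp [blockC, blockD]

lemma transferUpper_zero (T V : ℕ → Mat L) (z : ℂ) (a b : Fin L → ℂ) :
    transferUpper T V z a b 0 = a := by
  simp [transferUpper, transferState, transferProd]

lemma transferLower_zero (T V : ℕ → Mat L) (z : ℂ) (a b : Fin L → ℂ) :
    transferLower T V z a b 0 = b := by
  simp [transferLower, transferState, transferProd]

lemma transferState_succ (T V : ℕ → Mat L) (z : ℂ) (a b : Fin L → ℂ) (n : ℕ) :
    transferState T V z a b (n + 1) =
      transferM L z (T (n + 1)) (V (n + 1)) *ᵥ transferState T V z a b n := by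
  simp [transferState, transferProd, List.range_succ, mulVec_mulVec]

lemma transferLower_succ (T V : ℕ → Mat L) (z : ℂ) (a b : Fin L → ℂ) (n : ℕ) :
    transferLower T V z a b (n + 1) = (T (n + 1))⁻¹ *ᵥ transferUpper T V z a b n := by
  rw [transferLower, transferState_succ, transferM, fromBlocks_mulVec]
  simp [transferUpper]

lemma transferUpper_succ (T V : ℕ → Mat L) (z : ℂ) (a b : Fin L → ℂ) (n : ℕ) :
    transferUpper T V z a b (n + 1) =
      (z • (1 : Mat L) - V (n + 1)) *ᵥ transferLower T V z a b (n + 1)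
        - (T (n + 1))ᴴ *ᵥ transferLower T V z a b n := by
  rw [transferLower_succ, transferUpper, transferState_succ, transferM, fromBlocks_mulVec]
  simp [transferUpper, transferLower, mulVec_mulVec, neg_mulVec, sub_eq_add_neg]

lemma mulVec_transferLower_succ {T : ℕ → Mat L} (V : ℕ → Mat L) (z : ℂ) (a b : Fin L → ℂ) {n : ℕ}
    (hT : IsUnit (T (n + 1))) :
    T (n + 1) *ᵥ transferLower T V z a b (n + 1) = transferUpper T V z a b n := by
  rw [transferLower_succ, mulVec_mulVec, mul_nonsing_inv _ ((isUnit_iff_isUnit_det _).1 hT),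
    one_mulVec]

lemma jacobi_mulVec (N : ℕ) (T V : ℕ → Mat L) (Z : Mat L) (y : ℕ → Fin L → ℂ)
    (n : Fin N) (i : Fin L) :
    (jacobi L N T V 0 Z *ᵥ fun p => y (p.1 + 1) p.2) (n, i) =
      ((V (n + 1) - if n.val = N - 1 then Z else 0) *ᵥ y (n + 1)) i
        + (if n.val + 1 < N then (T (n + 2) *ᵥ y (n + 2)) i else 0)
        + (if n.val = 0 then 0 else ((T (n + 1))ᴴ *ᵥ y n) i) := by
  have key : ∀ m : Fin N, ∑ j, jacobi L N T V 0 Z (n, i) (m, j) * y (m + 1) j =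
      (if m.val = n.val then ((V (m + 1) - if m.val = N - 1 then Z else 0) *ᵥ y (m + 1)) i else 0)
      + (if m.val = n.val + 1 then (T (m + 1) *ᵥ y (m + 1)) i else 0)
      + (if n.val = m.val + 1 then ((T (m + 2))ᴴ *ᵥ y (m + 1)) i else 0) := by
    intro m
    by_cases h1 : n = m
    · subst h1
      simp [jacobi, mulVec, dotProduct]
    · have h1' : m.val ≠ n.val := fun h => h1 (Fin.ext h.symm)
      by_cases h2 : m.val = n.val + 1
      · have h3 : ¬ n.val = n.val + 1 + 1 := by omega
        simp [jacobi, mulVec, dotProduct, h1, h2, h3]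
      · by_cases h3 : n.val = m.val + 1
        · have h4 : ¬ m.val = m.val + 1 + 1 := by omega
          simp [jacobi, mulVec, dotProduct, h1, h3, h4]
        · simp [jacobi, h1, h1', h2, h3]
  rw [mulVec, dotProduct, Fintype.sum_prod_type]
  simp only [key]
  rw [Fin.sum_univ_eq_sum_range (fun m =>
      (if m = n.val then ((V (m + 1) - if m = N - 1 then Z else 0) *ᵥ y (m + 1)) i else 0)
      + (if m = n.val + 1 then (T (m + 1) *ᵥ y (m + 1)) i else 0)
      + (if n.val = m + 1 then ((T (m + 2))ᴴ *ᵥ y (m + 1)) i else 0)),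
    Finset.sum_add_distrib, Finset.sum_add_distrib]
  congr 1
  · simp [Finset.sum_ite_eq']
  · obtain ⟨n, hn⟩ := n
    rcases n with _ | n
    · simp
    · simp [Nat.lt_of_succ_lt hn, Finset.sum_ite_eq]

/-- A transfer matrix orbit solves the eigenvalue equation up to boundary terms. -/
lemma jacobi_sub_mulVec {N : ℕ} {T : ℕ → Mat L} (V : ℕ → Mat L) (hT1 : T 1 = 1)
    (hTinv : ∀ n, 2 ≤ n → n ≤ N → IsUnit (T n)) (Z : Mat L) (z : ℂ) (a b : Fin L → ℂ)
    (n : Fin N) (i : Fin L) :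
    ((jacobi L N T V 0 Z - z • 1) *ᵥ fun p => transferLower T V z a b (p.1 + 1) p.2) (n, i) =
      -(if n.val = 0 then b i else 0)
      - (if n.val = N - 1 then
          (transferUpper T V z a b N + Z *ᵥ transferLower T V z a b N) i else 0) := by
  have hup := congrFun (transferUpper_succ T V z a b n) i
  rw [sub_mulVec, Pi.sub_apply, jacobi_mulVec, smul_mulVec, one_mulVec]
  simp only [sub_mulVec, Pi.sub_apply, smul_mulVec, one_mulVec, Pi.smul_apply, smul_eq_mul] at hup ⊢
  have h0 : (if n.val = 0 then 0 else ((T (n + 1))ᴴ *ᵥ transferLower T V z a b n) i) =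
      ((T (n + 1))ᴴ *ᵥ transferLower T V z a b n) i - (if n.val = 0 then b i else 0) := by
    split_ifs with h
    · simp [h, hT1, transferLower_zero]
    · simp
  rw [h0]
  by_cases hN : n.val + 1 < N
  · have hne : n.val ≠ N - 1 := by omega
    have hT := congrFun (mulVec_transferLower_succ V z a b
      (hTinv (n + 1 + 1) (by omega) (by omega))) i
    simp only [hN, hne, if_true, if_false, zero_mulVec, Pi.zero_apply]
    linear_combination hT + hup
  · have heq : n.val = N - 1 := by omega
    have heq' : n.val + 1 = N := by omega
    simp only [hN, if_false, if_pos heq, Pi.add_apply]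
    rw [heq'] at hup ⊢
    linear_combination hup

lemma jacobi_isHermitian {N : ℕ} (T : ℕ → Mat L) {V : ℕ → Mat L}
    (hV : ∀ n, 1 ≤ n → n ≤ N → (V n).IsHermitian) {Z : Mat L} (hZ : Z.IsHermitian) :
    (jacobi L N T V 0 Z).IsHermitian := by
  ext ⟨m, i⟩ ⟨n, j⟩
  have hVm := (hV (m + 1) (by omega) (by omega)).apply i j
  have hZ := hZ.apply i j
  simp only [conjTranspose_apply, jacobi, of_apply]
  by_cases h1 : m = n
  · subst h1
    simp only [if_true, ite_self, sub_zero]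
    split_ifs <;> simp only [Matrix.sub_apply, star_sub, hVm, hZ, Matrix.zero_apply, star_zero]
  · have h1' : n ≠ m := fun h => h1 h.symm
    by_cases h2 : n.val = m.val + 1
    · have : ¬ m.val = m.val + 1 + 1 := by omega
      simp [h1, h1', h2, this]
    · by_cases h3 : m.val = n.val + 1
      · have : ¬ n.val = n.val + 1 + 1 := by omega
        simp [h1, h1', h3, this]
      · simp [h1, h1', h2, h3]

lemma im_star_dotProduct_sub_smul_mulVec {n : Type*} [Fintype n] [DecidableEq n]
    {M : Matrix n n ℂ} (hM : M.IsHermitian) (z : ℂ) (v : n → ℂ) :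
    (star v ⬝ᵥ (M - z • 1) *ᵥ v).im = -z.im * (star v ⬝ᵥ v).re := by
  have h1 : (star v ⬝ᵥ M *ᵥ v).im = 0 := hM.im_star_dotProduct_mulVec_self v
  have h2 : (star v ⬝ᵥ v).im = 0 := by
    simpa using (isHermitian_one (n := n) (α := ℂ)).im_star_dotProduct_mulVec_self v
  simp [sub_mulVec, dotProduct_sub, smul_mulVec, h1, h2]

lemma re_star_dotProduct_self_pos {n : Type*} [Fintype n] {v : n → ℂ} (hv : v ≠ 0) :
    0 < (star v ⬝ᵥ v).re :=
  (Complex.pos_iff.1 (dotProduct_star_self_pos_iff.2 hv)).1 |>.trans_eq (by rw [dotProduct_comm])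

lemma isUnit_of_mulVec_eq_zero {n : Type*} [Fintype n] [DecidableEq n] {M : Matrix n n ℂ}
    (h : ∀ v, M *ᵥ v = 0 → v = 0) : IsUnit M := by
  rw [← mulVec_injective_iff_isUnit]
  intro v w hvw
  exact sub_eq_zero.1 (h _ (by rw [mulVec_sub, sub_eq_zero]; exact hvw))

lemma isUnit_sub_smul_one_of_isHermitian {n : Type*} [Fintype n] [DecidableEq n]
    {M : Matrix n n ℂ} (hM : M.IsHermitian) {z : ℂ} (hz : z.im ≠ 0) : IsUnit (M - z • 1) := by
  refine isUnit_of_mulVec_eq_zero fun v hv => ?_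
  by_contra hne
  have h := im_star_dotProduct_sub_smul_mulVec hM z v
  rw [hv, dotProduct_zero, Complex.zero_im, eq_comm, neg_mul, neg_eq_zero, mul_eq_zero] at h
  exact h.elim hz (re_star_dotProduct_self_pos hne).ne'

/-- The sign of the Wronskian of a transfer matrix orbit with Dirichlet condition on the left. -/
lemma im_star_blockC_dotProduct_blockA {N : ℕ} (hN : 1 ≤ N) {T V : ℕ → Mat L} (hT1 : T 1 = 1)
    (hTinv : ∀ n, 2 ≤ n → n ≤ N → IsUnit (T n))
    (hV : ∀ n, 1 ≤ n → n ≤ N → (V n).IsHermitian) {z : ℂ} (hz : z.im < 0)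
    {u : Fin L → ℂ} (hu : u ≠ 0) :
    (star (blockC L N T V z *ᵥ u) ⬝ᵥ (blockA L N T V z *ᵥ u)).im < 0 := by
  set φ : Fin N × Fin L → ℂ := fun p => transferLower T V z u 0 (p.1 + 1) p.2 with hφ
  have hne : φ ≠ 0 := by
    intro h
    apply hu
    ext i
    simpa [hφ, transferLower_succ, transferUpper_zero, hT1] using congrFun h (⟨0, hN⟩, i)
  have h := im_star_dotProduct_sub_smul_mulVec
    (jacobi_isHermitian T hV (isHermitian_zero (n := Fin L) (α := ℂ))) z φ
  have hlast : star φ ⬝ᵥ (jacobi L N T V 0 0 - z • 1) *ᵥ φ =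
      -(star (blockC L N T V z *ᵥ u) ⬝ᵥ (blockA L N T V z *ᵥ u)) := by
    have hval : ∀ n : Fin N, n.val = N - 1 ↔ n = ⟨N - 1, by omega⟩ := fun n => by
      rw [Fin.ext_iff]
    rw [dotProduct, Fintype.sum_prod_type]
    simp only [hφ, jacobi_sub_mulVec V hT1 hTinv]
    simp only [hval, Pi.zero_apply, ite_self, neg_zero, zero_sub, zero_mulVec, add_zero, mul_neg,
      mul_ite, mul_zero, Finset.sum_neg_distrib]
    rw [Finset.sum_comm]
    simp only [Finset.sum_ite_eq', Finset.mem_univ, if_true, transferUpper_eq, transferLower_eq,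
      Nat.sub_add_cancel hN, mulVec_zero, add_zero, dotProduct, Pi.star_apply]
  rw [hlast, Complex.neg_im] at h
  nlinarith [re_star_dotProduct_self_pos hne]

lemma blockA_add_mul_blockC_mul_green {N : ℕ} (hN : 1 ≤ N) {T V : ℕ → Mat L} (hT1 : T 1 = 1)
    (hTinv : ∀ n, 2 ≤ n → n ≤ N → IsUnit (T n))
    (hV : ∀ n, 1 ≤ n → n ≤ N → (V n).IsHermitian) {Z : Mat L} (hZ : Z.IsHermitian)
    {z : ℂ} (hz : z.im < 0) :
    (blockA L N T V z + Z * blockC L N T V z) * green L N hN T V 0 Z z =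
      blockB L N T V z + Z * blockD L N T V z := by
  set K := blockA L N T V z + Z * blockC L N T V z with hK
  have hKu : IsUnit K := by
    refine isUnit_of_mulVec_eq_zero fun u hu => ?_
    by_contra hne
    have h := im_star_blockC_dotProduct_blockA hN hT1 hTinv hV hz hne
    have hA : blockA L N T V z *ᵥ u = -(Z *ᵥ (blockC L N T V z *ᵥ u)) := by
      rw [hK, add_mulVec, ← mulVec_mulVec] at hu
      exact eq_neg_of_add_eq_zero_left hu
    have hr := hZ.im_star_dotProduct_mulVec_self (blockC L N T V z *ᵥ u)
    rw [hA, dotProduct_neg, Complex.neg_im] at h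
    exact absurd h (by rw [show (_ : ℂ).im = 0 from hr]; simp)
  have hKd := (isUnit_iff_isUnit_det _).1 hKu
  suffices hG : green L N hN T V 0 Z z = K⁻¹ * (blockB L N T V z + Z * blockD L N T V z) by
    rw [hG, mul_nonsing_inv_cancel_left _ _ hKd]
  have hHd := (isUnit_iff_isUnit_det _).1
    (isUnit_sub_smul_one_of_isHermitian (jacobi_isHermitian T hV hZ) hz.ne)
  ext i j
  set e : Fin L → ℂ := Pi.single j 1 with he
  set a := (K⁻¹ * (blockB L N T V z + Z * blockD L N T V z)) *ᵥ e with ha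
  have hbd : transferUpper T V z a (-e) N + Z *ᵥ transferLower T V z a (-e) N = 0 := by
    have h1 : K *ᵥ a = (blockB L N T V z + Z * blockD L N T V z) *ᵥ e := by
      rw [ha, mulVec_mulVec, mul_nonsing_inv_cancel_left _ _ hKd]
    rw [hK, add_mulVec, add_mulVec, ← mulVec_mulVec, ← mulVec_mulVec] at h1
    rw [transferUpper_eq, transferLower_eq, mulVec_add, mulVec_neg, mulVec_neg, mulVec_neg,
      ← sub_eq_zero.2 h1]
    abel
  have hφ : (jacobi L N T V 0 Z - z • 1) *ᵥ
      (fun p => transferLower T V z a (-e) (p.1 + 1) p.2) = Pi.single (⟨0, hN⟩, j) 1 := by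
    ext ⟨n, k⟩
    rw [jacobi_sub_mulVec V hT1 hTinv, hbd]
    by_cases hn : n.val = 0
    · obtain rfl : n = ⟨0, hN⟩ := Fin.ext hn
      by_cases hk : k = j
      · subst hk; simp [he]
      · simp [he, hk]
    · have hn' : n ≠ ⟨0, hN⟩ := fun h => hn (by rw [h])
      simp [hn, hn']
  have hsol := congrArg ((jacobi L N T V 0 Z - z • 1)⁻¹ *ᵥ ·) hφ
  simp only [mulVec_mulVec, nonsing_inv_mul _ hHd, one_mulVec, mulVec_single_one] at hsol
  have h0 := congrFun hsol (⟨0, hN⟩, i)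
  simp only [transferLower_succ, hT1, zero_add, transferUpper_zero, inv_one, one_mulVec] at h0
  rw [green, of_apply]
  refine h0.symm.trans ?_
  simp [ha, he]

lemma green_conjTranspose {N : ℕ} (hN : 1 ≤ N) (T : ℕ → Mat L) {V : ℕ → Mat L}
    (hV : ∀ n, 1 ≤ n → n ≤ N → (V n).IsHermitian) {Z : Mat L} (hZ : Z.IsHermitian) (z : ℂ) :
    (green L N hN T V 0 Z (starRingEnd ℂ z))ᴴ = green L N hN T V 0 Z z := by
  have h : ((jacobi L N T V 0 Z - starRingEnd ℂ z • 1)⁻¹)ᴴ = (jacobi L N T V 0 Z - z • 1)⁻¹ := by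
    rw [conjTranspose_nonsing_inv, conjTranspose_sub, (jacobi_isHermitian T hV hZ).eq]
    simp
  ext i j
  simp only [green, conjTranspose_apply, of_apply, ← h]

/-- The denominator of the Green matrix as a Möbius transform of a contraction. -/
lemma isUnit_denominator {N : ℕ} (hN : 1 ≤ N) {T V : ℕ → Mat L} (hT1 : T 1 = 1)
    (hTinv : ∀ n, 2 ≤ n → n ≤ N → IsUnit (T n))
    (hV : ∀ n, 1 ≤ n → n ≤ N → (V n).IsHermitian) {z : ℂ} (hz : z.im < 0) {W : Mat L}
    (hW : ∀ v, (star (Wᴴ *ᵥ v) ⬝ᵥ (Wᴴ *ᵥ v)).re ≤ (star v ⬝ᵥ v).re) :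
    IsUnit ((blockA L N T V z)ᴴ + Complex.I • (blockC L N T V z)ᴴ
      + (Complex.I • (blockC L N T V z)ᴴ - (blockA L N T V z)ᴴ) * W) := by
  rw [← isUnit_conjTranspose]
  refine isUnit_of_mulVec_eq_zero fun u hu => ?_
  by_contra hne
  have h := im_star_blockC_dotProduct_blockA hN hT1 hTinv hV hz hne
  set x := blockA L N T V z *ᵥ u with hx
  set y := blockC L N T V z *ᵥ u with hy
  have heq : Wᴴ *ᵥ (x + Complex.I • y) = x - Complex.I • y := by
    simp only [conjTranspose_add, conjTranspose_sub, conjTranspose_mul, conjTranspose_smul,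
      conjTranspose_conjTranspose, add_mulVec, ← mulVec_mulVec, sub_mulVec, smul_mulVec, ← hx,
      ← hy, RCLike.star_def, Complex.conj_I, mulVec_sub, mulVec_smul, mulVec_neg, neg_mulVec, neg_smul] at hu
    rw [mulVec_add, mulVec_smul, ← sub_eq_zero, ← neg_eq_zero, ← hu]
    abel
  have hle := hW (x + Complex.I • y)
  have hconj : star x ⬝ᵥ y = star (star y ⬝ᵥ x) := by
    rw [star_dotProduct]
  rw [heq] at hle
  simp only [star_sub, star_add, star_smul, sub_dotProduct, add_dotProduct, dotProduct_sub,
    dotProduct_add, smul_dotProduct, dotProduct_smul, hconj] at hle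
  simp at hle
  linarith

/-- The Green matrix as a function of the inverse `W` of the unitary parametrizing the right
boundary condition. -/
def greenMobius (T V : ℕ → Mat L) (N : ℕ) (z : ℂ) (W : Mat L) : Mat L :=
  ((blockB L N T V z)ᴴ + Complex.I • (blockD L N T V z)ᴴ
      + (Complex.I • (blockD L N T V z)ᴴ - (blockB L N T V z)ᴴ) * W)
    * ((blockA L N T V z)ᴴ + Complex.I • (blockC L N T V z)ᴴ
      + (Complex.I • (blockC L N T V z)ᴴ - (blockA L N T V z)ᴴ) * W)⁻¹

lemma re_star_dotProduct_smul_unitary_le (U : unitaryGroup (Fin L) ℂ) {w : ℂ} (hw : ‖w‖ ≤ 1)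
    (v : Fin L → ℂ) :
    (star ((w • star (U : Mat L))ᴴ *ᵥ v) ⬝ᵥ ((w • star (U : Mat L))ᴴ *ᵥ v)).re ≤
      (star v ⬝ᵥ v).re := by
  have h1 : star ((w • star (U : Mat L))ᴴ *ᵥ v) ⬝ᵥ ((w • star (U : Mat L))ᴴ *ᵥ v) =
      ((‖w‖ ^ 2 : ℝ) : ℂ) * (star v ⬝ᵥ v) := by
    have hU : (U : Mat L)ᴴ * (U : Mat L) = 1 := UnitaryGroup.star_mul_self U
    rw [star_mulVec, ← dotProduct_mulVec, mulVec_mulVec, conjTranspose_conjTranspose,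
      conjTranspose_smul, star_eq_conjTranspose, conjTranspose_conjTranspose, smul_mul_smul_comm,
      hU, smul_mulVec, one_mulVec, dotProduct_smul, smul_eq_mul, RCLike.star_def,
      Complex.mul_conj']
    simp
  rw [h1, Complex.re_ofReal_mul]
  have h0 : 0 ≤ (star v ⬝ᵥ v).re := (Complex.nonneg_iff.1 (dotProduct_star_self_nonneg v)).1
  exact mul_le_of_le_one_left h0 (pow_le_one₀ (norm_nonneg w) hw)

lemma ZofU_mul_one_sub_star {U : unitaryGroup (Fin L) ℂ} (hU : IsUnit (1 - (U : Mat L))) :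
    ZofU L U * (1 - star (U : Mat L)) = Complex.I • (1 + star (U : Mat L)) := by
  have h1 : 1 - star (U : Mat L) = -((1 - (U : Mat L)) * star (U : Mat L)) := by
    rw [sub_mul, (mem_unitaryGroup_iff.1 U.2), one_mul, neg_sub]
  rw [ZofU, h1, neg_mul_neg, smul_mul_assoc, ← mul_assoc, nonsing_inv_mul_cancel_right _ _
    ((isUnit_iff_isUnit_det _).1 hU), add_mul, (mem_unitaryGroup_iff.1 U.2), one_mul, add_comm]

lemma isHermitian_ZofU {U : unitaryGroup (Fin L) ℂ} (hU : IsUnit (1 - (U : Mat L))) :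
    (ZofU L U).IsHermitian := by
  have hU' : IsUnit (1 - star (U : Mat L)) := by
    simpa using hU.star
  have hUd := (isUnit_iff_isUnit_det _).1 hU
  have h := congrArg star (ZofU_mul_one_sub_star hU)
  rw [star_mul, star_smul, star_sub, star_add, star_one, star_star] at h
  have hcomm : (1 - (U : Mat L)) * (1 + U) = (1 + U) * (1 - U) := by noncomm_ring
  have h2 : (1 - (U : Mat L)) * ZofU L U = -(Complex.I • (1 + (U : Mat L))) := by
    rw [ZofU, mul_neg, mul_smul_comm, ← mul_assoc, hcomm, mul_nonsing_inv_cancel_right _ _ hUd]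
  have h3 : (1 - (U : Mat L)) * star (ZofU L U) = (1 - (U : Mat L)) * ZofU L U := by
    rw [h, h2]; simp [-smul_add]
  exact hU.mul_left_cancel h3

lemma green_ZofU {N : ℕ} (hN : 1 ≤ N) {T V : ℕ → Mat L} (hT1 : T 1 = 1)
    (hTinv : ∀ n, 2 ≤ n → n ≤ N → IsUnit (T n))
    (hV : ∀ n, 1 ≤ n → n ≤ N → (V n).IsHermitian) {z : ℂ} (hz : 0 < z.im)
    {U : unitaryGroup (Fin L) ℂ} (hU : IsUnit (1 - (U : Mat L))) :
    green L N hN T V 0 (ZofU L U) z =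
      greenMobius T V N (starRingEnd ℂ z) (star (U : Mat L)) := by
  have hz' : (starRingEnd ℂ z).im < 0 := by simpa using hz
  have hZ := isHermitian_ZofU hU
  have hunit := isUnit_denominator hN hT1 hTinv hV hz' (W := star (U : Mat L))
    (by simpa using re_star_dotProduct_smul_unitary_le U (w := 1) (by simp))
  have h := congrArg conjTranspose
    (blockA_add_mul_blockC_mul_green hN hT1 hTinv hV hZ hz')
  simp only [conjTranspose_mul, conjTranspose_add, green_conjTranspose hN T hV hZ, hZ.eq] at h
  rw [greenMobius, ← mul_nonsing_inv_cancel_right _ (green L N hN T V 0 (ZofU L U) z)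
    ((isUnit_iff_isUnit_det _).1 hunit)]
  congr 1
  have hden (M M' : Mat L) : M + Complex.I • M' + (Complex.I • M' - M) * star (U : Mat L) =
      (M + M' * ZofU L U) * (1 - star (U : Mat L)) := by
    rw [add_mul M, mul_assoc, ZofU_mul_one_sub_star hU, mul_smul_comm, mul_add, mul_sub, sub_mul,
      smul_mul_assoc, mul_one, mul_one, smul_add]
    abel
  rw [hden, hden, ← mul_assoc, h]

instance (L : ℕ) : BorelSpace (unitaryGroup (Fin L) ℂ) := ⟨rfl⟩

instance (L : ℕ) : IsTopologicalGroup (unitaryGroup (Fin L) ℂ) :=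
  inferInstanceAs (IsTopologicalGroup (unitary (Matrix (Fin L) (Fin L) ℂ)))

instance (L : ℕ) : CompactSpace (unitaryGroup (Fin L) ℂ) := by
  have hcl : IsClosed (unitaryGroup (Fin L) ℂ : Set (Mat L)) :=
    isClosed_unitary (R := Matrix (Fin L) (Fin L) ℂ)
  refine isCompact_iff_compactSpace.1 (IsCompact.of_isClosed_subset
    (isCompact_univ_pi fun _ => isCompact_univ_pi fun _ => isCompact_closedBall (0 : ℂ) 1) hcl ?_)
  intro U hU i _ j _
  simpa using entry_norm_bound_of_unitary hU i j

instance (L : ℕ) : SecondCountableTopology (unitaryGroup (Fin L) ℂ) :=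
  haveI : SecondCountableTopology (Mat L) :=
    inferInstanceAs (SecondCountableTopology (Fin L → Fin L → ℂ))
  Topology.IsInducing.subtypeVal.secondCountableTopology

/-- The scalar unitary matrix `exp (-iθ)`. -/
def unitaryRotation (L : ℕ) (θ : ℝ) : unitaryGroup (Fin L) ℂ :=
  ⟨Complex.exp (-(θ * Complex.I)) • 1, by
    rw [mem_unitaryGroup_iff, star_smul, star_one, smul_mul_smul_comm, one_mul, RCLike.star_def,
      ← Complex.exp_conj, ← Complex.exp_add]
    simp⟩

lemma coe_unitaryRotation_mul (θ : ℝ) (U : unitaryGroup (Fin L) ℂ) :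
    ((unitaryRotation L θ * U : unitaryGroup (Fin L) ℂ) : Mat L) =
      Complex.exp (-(θ * Complex.I)) • (U : Mat L) := by
  simp [unitaryRotation]

lemma star_unitaryRotation_mul (θ : ℝ) (U : unitaryGroup (Fin L) ℂ) :
    star ((unitaryRotation L θ * U : unitaryGroup (Fin L) ℂ) : Mat L) =
      circleMap 0 1 θ • star (U : Mat L) := by
  rw [coe_unitaryRotation_mul, star_smul, RCLike.star_def, ← Complex.exp_conj]
  simp [circleMap]

lemma continuous_unitaryRotation : Continuous (unitaryRotation L) := by
  unfold unitaryRotation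
  fun_prop

/-- Mean value property for functions of a Haar distributed unitary matrix. -/
lemma integral_star_unitary_eq_apply_zero (μ : Measure (unitaryGroup (Fin L) ℂ))
    [μ.IsHaarMeasure] [IsProbabilityMeasure μ] {f : Mat L → ℂ}
    (hc : Continuous fun U : unitaryGroup (Fin L) ℂ => f (star (U : Mat L)))
    (hd : ∀ U : unitaryGroup (Fin L) ℂ,
      DiffContOnCl ℂ (fun w : ℂ => f (w • star (U : Mat L))) (Metric.ball 0 1)) :
    ∫ U, f (star (U : Mat L)) ∂μ = f 0 := by
  set h : unitaryGroup (Fin L) ℂ → ℂ := fun U => f (star (U : Mat L)) with hh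
  obtain ⟨C, hC⟩ := (isCompact_range hc).isBounded.exists_norm_le
  have hcont : Continuous fun p : ℝ × unitaryGroup (Fin L) ℂ => h (unitaryRotation L p.1 * p.2) :=
    hc.comp ((continuous_unitaryRotation.comp continuous_fst).mul continuous_snd)
  have : IsFiniteMeasure (volume.restrict (Set.uIoc 0 (2 * Real.pi))) := by
    rw [Set.uIoc_of_le Real.two_pi_pos.le]; infer_instance
  have hint : Integrable (Function.uncurry fun (θ : ℝ) U => h (unitaryRotation L θ * U))
      ((volume.restrict (Set.uIoc 0 (2 * Real.pi))).prod μ) :=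
    Integrable.of_bound hcont.aestronglyMeasurable C
      (Filter.Eventually.of_forall fun p => hC _ ⟨_, rfl⟩)
  have hswap := intervalIntegral_integral_swap hint
  have hrot : ∀ θ : ℝ, ∫ U, h (unitaryRotation L θ * U) ∂μ = ∫ U, h U ∂μ := fun θ =>
    integral_mul_left_eq_self h _
  have hmean : ∀ U, ∫ θ in (0 : ℝ)..2 * Real.pi, h (unitaryRotation L θ * U) =
      (2 * Real.pi : ℝ) • f 0 := by
    intro U
    have := DiffContOnCl.circleAverage (c := 0) (R := 1) (by simpa using hd U)
    rw [Real.circleAverage_def, zero_smul] at this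
    simp only [hh, star_unitaryRotation_mul]
    rw [← this, smul_inv_smul₀ Real.two_pi_pos.ne']
  simp only [hrot, hmean, intervalIntegral.integral_const, integral_const, sub_zero,
    probReal_univ, one_smul] at hswap
  exact smul_right_injective _ Real.two_pi_pos.ne' hswap

lemma countable_setOf_not_isUnit (U : unitaryGroup (Fin L) ℂ) :
    {θ : ℝ | ¬ IsUnit (1 - ((unitaryRotation L θ * U :
      unitaryGroup (Fin L) ℂ) : Mat L))}.Countable := by
  have hroots : (spectrum ℂ (U : Mat L)).Finite := Matrix.finite_spectrum _
  have hsub : {θ : ℝ | ¬ IsUnit (1 - ((unitaryRotation L θ * U :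
      unitaryGroup (Fin L) ℂ) : Mat L))} ⊆
      ⋃ w ∈ spectrum ℂ (U : Mat L), {θ : ℝ | Complex.exp (θ * Complex.I) = w} := by
    intro θ hθ
    simp only [Set.mem_iUnion, Set.mem_ofPred_eq, exists_prop, exists_eq_right']
    intro hu
    refine hθ ?_
    have : 1 - ((unitaryRotation L θ * U : unitaryGroup (Fin L) ℂ) : Mat L) =
        algebraMap ℂ (Mat L) (Complex.exp (-(θ * Complex.I))) *
          (algebraMap ℂ (Mat L) (Complex.exp (θ * Complex.I)) - U) := by
      rw [coe_unitaryRotation_mul, mul_sub, ← map_mul, ← Complex.exp_add, Algebra.smul_def]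
      simp
    rw [this]
    exact ((IsUnit.mk0 _ (Complex.exp_ne_zero _)).map _).mul hu
  refine (hroots.countable.biUnion fun w _ => ?_).mono hsub
  by_cases hw : ∃ θ₀ : ℝ, Complex.exp (θ₀ * Complex.I) = w
  · obtain ⟨θ₀, rfl⟩ := hw
    refine (Set.countable_range fun n : ℤ => θ₀ + n * (2 * Real.pi)).mono fun θ hθ => ?_
    obtain ⟨n, hn⟩ := Complex.exp_eq_exp_iff_exists_int.1 hθ
    refine ⟨n, ?_⟩
    have : (θ : ℂ) = θ₀ + n * (2 * Real.pi) :=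
      mul_right_cancel₀ Complex.I_ne_zero (by rw [hn]; ring)
    exact_mod_cast this.symm
  · convert Set.countable_empty
    exact Set.eq_empty_of_forall_notMem fun θ hθ => hw ⟨θ, hθ⟩

lemma ae_isUnit_one_sub (μ : Measure (unitaryGroup (Fin L) ℂ))
    [μ.IsHaarMeasure] [IsProbabilityMeasure μ] :
    ∀ᵐ U : unitaryGroup (Fin L) ℂ ∂μ, IsUnit (1 - (U : Mat L)) := by
  set S : Set (unitaryGroup (Fin L) ℂ) := {U | ¬ IsUnit (1 - (U : Mat L))} with hS
  have hScl : IsClosed S := by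
    have : S = (fun U : unitaryGroup (Fin L) ℂ => (1 - (U : Mat L)).det) ⁻¹' {0} := by
      ext U; simp [hS, isUnit_iff_isUnit_det]
    rw [this]
    exact isClosed_singleton.preimage (by fun_prop)
  have hcont : Continuous fun p : unitaryGroup (Fin L) ℂ × ℝ => unitaryRotation L p.2 * p.1 :=
    (continuous_unitaryRotation.comp continuous_snd).mul continuous_fst
  have hnull : (μ.prod (volume : Measure ℝ))
      ((fun p : unitaryGroup (Fin L) ℂ × ℝ => unitaryRotation L p.2 * p.1) ⁻¹' S) = 0 := by
    rw [Measure.measure_prod_null (hScl.preimage hcont).measurableSet]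
    exact Filter.Eventually.of_forall fun U => (countable_setOf_not_isUnit U).measure_zero _
  rw [← Measure.prod_swap, Measure.map_apply measurable_swap
    (hScl.preimage hcont).measurableSet] at hnull
  obtain ⟨θ, hθ⟩ := (Measure.measure_ae_null_of_prod_null hnull).exists
  have : μ ((unitaryRotation L θ * ·) ⁻¹' S) = 0 := hθ
  rwa [measure_preimage_mul] at this

lemma DifferentiableAt.matrix_det {M : ℂ → Mat L} {w : ℂ}
    (hM : ∀ i j, DifferentiableAt ℂ (fun w => M w i j) w) :
    DifferentiableAt ℂ (fun w => (M w).det) w := by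
  simp only [det_apply']
  fun_prop

lemma DifferentiableAt.matrix_inv_apply {M : ℂ → Mat L} {w : ℂ}
    (hM : ∀ i j, DifferentiableAt ℂ (fun w => M w i j) w) (hu : IsUnit (M w)) (i j : Fin L) :
    DifferentiableAt ℂ (fun w => (M w)⁻¹ i j) w := by
  have hdet : (M w).det ≠ 0 := ((isUnit_iff_isUnit_det _).1 hu).ne_zero
  simp only [inv_def, Ring.inverse_eq_inv', Matrix.smul_apply, smul_eq_mul, adjugate_apply]
  refine ((DifferentiableAt.matrix_det hM).inv hdet).mul (DifferentiableAt.matrix_det fun k l => ?_)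
  simp only [updateRow_apply]
  split_ifs
  · exact differentiableAt_const _
  · exact hM k l

lemma continuous_greenMobius {N : ℕ} (hN : 1 ≤ N) {T V : ℕ → Mat L} (hT1 : T 1 = 1)
    (hTinv : ∀ n, 2 ≤ n → n ≤ N → IsUnit (T n))
    (hV : ∀ n, 1 ≤ n → n ≤ N → (V n).IsHermitian) {z : ℂ} (hz : z.im < 0) :
    Continuous fun U : unitaryGroup (Fin L) ℂ => greenMobius T V N z (star (U : Mat L)) := by
  refine continuous_iff_continuousAt.2 fun U => ?_
  have hu := isUnit_denominator hN hT1 hTinv hV hz (W := star (U : Mat L))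
    (by simpa using re_star_dotProduct_smul_unitary_le U (w := 1) (by simp))
  unfold greenMobius
  refine ContinuousAt.mul (by fun_prop) (ContinuousAt.comp (f := fun U : unitaryGroup (Fin L) ℂ =>
    (blockA L N T V z)ᴴ + Complex.I • (blockC L N T V z)ᴴ
      + (Complex.I • (blockC L N T V z)ᴴ - (blockA L N T V z)ᴴ) * star (U : Mat L))
    (g := Inv.inv) (continuousAt_matrix_inv _ ?_) (by fun_prop))
  simpa only [Ring.inverse_eq_inv'] using
    continuousAt_inv₀ ((isUnit_iff_isUnit_det _).1 hu).ne_zero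

lemma diffContOnCl_greenMobius {N : ℕ} (hN : 1 ≤ N) {T V : ℕ → Mat L} (hT1 : T 1 = 1)
    (hTinv : ∀ n, 2 ≤ n → n ≤ N → IsUnit (T n))
    (hV : ∀ n, 1 ≤ n → n ≤ N → (V n).IsHermitian) {z : ℂ} (hz : z.im < 0)
    (U : unitaryGroup (Fin L) ℂ) (i j : Fin L) :
    DiffContOnCl ℂ (fun w : ℂ => greenMobius T V N z (w • star (U : Mat L)) i j)
      (Metric.ball 0 1) := by
  refine DifferentiableOn.diffContOnCl fun w hw => DifferentiableAt.differentiableWithinAt ?_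
  rw [closure_ball _ one_ne_zero, mem_closedBall_zero_iff] at hw
  have hu := isUnit_denominator hN hT1 hTinv hV hz (re_star_dotProduct_smul_unitary_le U hw)
  have haff (P Q : Mat L) (k l : Fin L) :
      DifferentiableAt ℂ (fun w : ℂ => (P + Q * (w • star (U : Mat L))) k l) w := by
    simp only [Matrix.add_apply, mul_smul_comm, Matrix.smul_apply, smul_eq_mul]
    fun_prop
  unfold greenMobius
  simp only [mul_apply (N := _⁻¹)]
  refine DifferentiableAt.fun_sum fun k _ => (haff _ _ i k).mul
    (DifferentiableAt.matrix_inv_apply (haff _ _) hu k j)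
end

theorem stmt7 (L N : ℕ) (hL : 1 ≤ L) (hN : 1 ≤ N)
    (T V : ℕ → Mat L) (hT1 : T 1 = 1)
    (hTinv : ∀ n, 2 ≤ n → n ≤ N → IsUnit (T n))
    (hV : ∀ n, 1 ≤ n → n ≤ N → (V n).IsHermitian)
    (μ : Measure (Matrix.unitaryGroup (Fin L) ℂ))
    [μ.IsHaarMeasure] [IsProbabilityMeasure μ]
    (z : ℂ) (hz : 0 < z.im) :
    IsUnit ((blockA L N T V (starRingEnd ℂ z))ᴴ
        + Complex.I • (blockC L N T V (starRingEnd ℂ z))ᴴ) ∧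
    (∀ i j : Fin L,
      (∫ U, green L N hN T V 0 (ZofU L U) z i j ∂μ) =
        (((blockB L N T V (starRingEnd ℂ z))ᴴ
            + Complex.I • (blockD L N T V (starRingEnd ℂ z))ᴴ)
          * ((blockA L N T V (starRingEnd ℂ z))ᴴ
            + Complex.I • (blockC L N T V (starRingEnd ℂ z))ᴴ)⁻¹) i j) := by
  have hz' : (starRingEnd ℂ z).im < 0 := by simpa using hz
  have hA := isUnit_denominator hN hT1 hTinv hV hz' (W := 0) fun v => by
    simpa using (Complex.nonneg_iff.1 (dotProduct_star_self_nonneg v)).1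
  rw [mul_zero, add_zero] at hA
  refine ⟨hA, fun i j => ?_⟩
  have hae : (fun U => green L N hN T V 0 (ZofU L U) z i j) =ᵐ[μ]
      fun U => greenMobius T V N (starRingEnd ℂ z) (star (U : Mat L)) i j := by
    filter_upwards [ae_isUnit_one_sub μ] with U hU
    rw [green_ZofU hN hT1 hTinv hV hz hU]
  rw [integral_congr_ae hae, integral_star_unitary_eq_apply_zero μ
    (f := fun W => greenMobius T V N (starRingEnd ℂ z) W i j)
    ((continuous_greenMobius hN hT1 hTinv hV hz').matrix_elem i j)
    (fun U => diffContOnCl_greenMobius hN hT1 hTinv hV hz' U i j)]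
  simp only [greenMobius, mul_zero, add_zero]
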